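/- arXiv:1106.3175 — 7 statements merged into one kernel-verified Lean document; each statement's English description precedes it below -/
import Mathlib

section
/- For the canal surface C, the coefficients of the first fundamental form are given for every (s,t) by E = Q²κ²cos²(t) + (2Q − 2QR′ + 2Q′R)κcos(t) + 2QRκτ·sin(t) + Q²τ² + (Q′)² + R²κ² + 1 − 2R′ + (R′)², F = −Q(Rκ·sin(t) + Qτ), and G = Q², where all functions R, Q, κ, τ, r are evaluated at s. -/
open scoped RealInnerProductSpace

/-- The inner product of two vectors given by their coordinates in an orthonormal triple. -/
theorem inner_combination_of_orthonormal_triple {V : Type*} [NormedAddCommGroup V]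
    [InnerProductSpace ℝ V] {x y z : V} (hx : ‖x‖ = 1) (hy : ‖y‖ = 1) (hz : ‖z‖ = 1)
    (hxy : ⟪x, y⟫ = 0) (hxz : ⟪x, z⟫ = 0) (hyz : ⟪y, z⟫ = 0) (a b c a' b' c' : ℝ) :
    ⟪a • x + b • y + c • z, a' • x + b' • y + c' • z⟫ = a * a' + b * b' + c * c' := by
  have hyx : ⟪y, x⟫ = 0 := by rw [real_inner_comm, hxy]
  have hzx : ⟪z, x⟫ = 0 := by rw [real_inner_comm, hxz]
  have hzy : ⟪z, y⟫ = 0 := by rw [real_inner_comm, hyz]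
  simp only [inner_add_left, inner_add_right, real_inner_smul_left, real_inner_smul_right,
    real_inner_self_eq_norm_sq, hx, hy, hz, hxy, hxz, hyz, hyx, hzx, hzy]
  ring

theorem canal_first_fundamental_form
    (α T N B : ℝ → EuclideanSpace ℝ (Fin 3)) (κ τ r : ℝ → ℝ)
    (hα : ContDiff ℝ (⊤ : ℕ∞) α) (hT : ContDiff ℝ (⊤ : ℕ∞) T)
    (hN : ContDiff ℝ (⊤ : ℕ∞) N) (hB : ContDiff ℝ (⊤ : ℕ∞) B)
    (hκ : ContDiff ℝ (⊤ : ℕ∞) κ) (hτ : ContDiff ℝ (⊤ : ℕ∞) τ)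
    (hr : ContDiff ℝ (⊤ : ℕ∞) r)
    (hTα : ∀ s, T s = deriv α s)
    (hT1 : ∀ s, ‖T s‖ = 1) (hN1 : ∀ s, ‖N s‖ = 1) (hB1 : ∀ s, ‖B s‖ = 1)
    (hTN : ∀ s, ⟪T s, N s⟫ = 0) (hTB : ∀ s, ⟪T s, B s⟫ = 0)
    (hNB : ∀ s, ⟪N s, B s⟫ = 0)
    (hT' : ∀ s, deriv T s = κ s • N s)
    (hN' : ∀ s, deriv N s = (-κ s) • T s + τ s • B s)
    (hB' : ∀ s, deriv B s = (-τ s) • N s)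
    (hrpos : ∀ s, 0 < r s) (hr1 : ∀ s, |deriv r s| < 1)
    (R Q : ℝ → ℝ)
    (hR : ∀ s, R s = r s * deriv r s)
    (hQ : ∀ s, Q s = r s * Real.sqrt (1 - (deriv r s) ^ 2))
    (C : ℝ → ℝ → EuclideanSpace ℝ (Fin 3))
    (hC : ∀ s t, C s t = α s - R s • T s - (Q s * Real.cos t) • N s
      + (Q s * Real.sin t) • B s)
    (Cs Ct : ℝ → ℝ → EuclideanSpace ℝ (Fin 3))
    (hCs : ∀ s t, Cs s t = deriv (fun u => C u t) s)
    (hCt : ∀ s t, Ct s t = deriv (fun u => C s u) t)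
    (E F G : ℝ → ℝ → ℝ)
    (hE : ∀ s t, E s t = ⟪Cs s t, Cs s t⟫)
    (hF : ∀ s t, F s t = ⟪Cs s t, Ct s t⟫)
    (hG : ∀ s t, G s t = ⟪Ct s t, Ct s t⟫)
    :
    ∀ s t : ℝ,
      E s t = Q s ^ 2 * κ s ^ 2 * Real.cos t ^ 2
          + (2 * Q s - 2 * Q s * deriv R s + 2 * deriv Q s * R s) * κ s * Real.cos t
          + 2 * Q s * R s * κ s * τ s * Real.sin t + Q s ^ 2 * τ s ^ 2
          + (deriv Q s) ^ 2 + R s ^ 2 * κ s ^ 2 + 1 - 2 * deriv R s + (deriv R s) ^ 2 ∧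
        F s t = -(Q s * (R s * κ s * Real.sin t + Q s * τ s)) ∧
        G s t = Q s ^ 2 := by
  intro s t
  have hr' : Differentiable ℝ (deriv r) :=
    ((contDiff_infty_iff_deriv.mp hr).2).differentiable (by simp)
  have hr0 : Differentiable ℝ r := hr.differentiable (by simp)
  have hRs : HasDerivAt R (deriv R s) s := by
    rw [funext hR]
    exact ((hr0 s).mul (hr' s)).hasDerivAt
  have hQs : HasDerivAt Q (deriv Q s) s := by
    have hpos : 0 < 1 - deriv r s ^ 2 := sub_pos.mpr ((sq_lt_one_iff_abs_lt_one _).mpr (hr1 s))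
    rw [funext hQ]
    exact ((hr0 s).mul ((((hr' s).pow 2).const_sub 1).sqrt hpos.ne')).hasDerivAt
  have hαs : HasDerivAt α (T s) s := hTα s ▸ (hα.differentiable (by simp) s).hasDerivAt
  have hTs : HasDerivAt T (κ s • N s) s := hT' s ▸ (hT.differentiable (by simp) s).hasDerivAt
  have hNs : HasDerivAt N ((-κ s) • T s + τ s • B s) s :=
    hN' s ▸ (hN.differentiable (by simp) s).hasDerivAt
  have hBs : HasDerivAt B ((-τ s) • N s) s := hB' s ▸ (hB.differentiable (by simp) s).hasDerivAt
  have hCs' : Cs s t = (1 - deriv R s + Q s * κ s * Real.cos t) • T s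
      + (-(R s * κ s) - deriv Q s * Real.cos t - Q s * τ s * Real.sin t) • N s
      + (deriv Q s * Real.sin t - Q s * τ s * Real.cos t) • B s := by
    rw [hCs, funext fun u => hC u t]
    refine (((hαs.sub (hRs.smul hTs)).sub ((hQs.mul_const (Real.cos t)).smul hNs)).add
      ((hQs.mul_const (Real.sin t)).smul hBs)).deriv.trans ?_
    module
  have hCt' : Ct s t = (0 : ℝ) • T s + (Q s * Real.sin t) • N s + (Q s * Real.cos t) • B s := by
    rw [hCt, funext fun u => hC s u]
    refine (((((Real.hasDerivAt_cos t).const_mul (Q s)).smul_const (N s)).const_sub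
      (α s - R s • T s)).add
      (((Real.hasDerivAt_sin t).const_mul (Q s)).smul_const (B s))).deriv.trans ?_
    module
  have hsc := Real.sin_sq_add_cos_sq t
  rw [hE, hF, hG, hCs', hCt']
  simp only [inner_combination_of_orthonormal_triple (hT1 s) (hN1 s) (hB1 s) (hTN s) (hTB s)
    (hNB s)]
  refine ⟨?_, ?_, ?_⟩
  · linear_combination (deriv Q s ^ 2 + Q s ^ 2 * τ s ^ 2) * hsc
  · linear_combination -(Q s ^ 2 * τ s) * hsc
  · linear_combination Q s ^ 2 * hsc
end

section
/- For the canal surface C, the discriminant of the first fundamental form satisfies, for every (s,t), EG − F² = Q²·{ κ²(R² + Q²)cos²(t) + 2κ(Q′R − QR′ + Q)cos(t) + 1 − 2R′ + (R′)² + (Q′)² }, where all functions R, Q, κ are evaluated at s. -/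
open scoped RealInnerProductSpace

/-- The inner product of two combinations of an orthonormal triple, in coordinates. -/
theorem inner_frame_combination {V : Type*} [NormedAddCommGroup V] [InnerProductSpace ℝ V]
    {u v w : V} (hu : ‖u‖ = 1) (hv : ‖v‖ = 1) (hw : ‖w‖ = 1)
    (huv : ⟪u, v⟫ = 0) (huw : ⟪u, w⟫ = 0) (hvw : ⟪v, w⟫ = 0) (a b c a' b' c' : ℝ) :
    ⟪a • u + b • v + c • w, a' • u + b' • v + c' • w⟫ = a * a' + b * b' + c * c' := by
  have hvu : ⟪v, u⟫ = 0 := by rw [real_inner_comm, huv]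
  have hwu : ⟪w, u⟫ = 0 := by rw [real_inner_comm, huw]
  have hwv : ⟪w, v⟫ = 0 := by rw [real_inner_comm, hvw]
  simp only [inner_add_left, inner_add_right, real_inner_smul_left, real_inner_smul_right,
    real_inner_self_eq_norm_sq, hu, hv, hw, huv, huw, hvw, hvu, hwu, hwv]
  ring

theorem canal_first_fundamental_discriminant
    (α T N B : ℝ → EuclideanSpace ℝ (Fin 3)) (κ τ r : ℝ → ℝ)
    (hα : ContDiff ℝ (⊤ : ℕ∞) α) (hT : ContDiff ℝ (⊤ : ℕ∞) T)
    (hN : ContDiff ℝ (⊤ : ℕ∞) N) (hB : ContDiff ℝ (⊤ : ℕ∞) B)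
    (hκ : ContDiff ℝ (⊤ : ℕ∞) κ) (hτ : ContDiff ℝ (⊤ : ℕ∞) τ)
    (hr : ContDiff ℝ (⊤ : ℕ∞) r)
    (hTα : ∀ s, T s = deriv α s)
    (hT1 : ∀ s, ‖T s‖ = 1) (hN1 : ∀ s, ‖N s‖ = 1) (hB1 : ∀ s, ‖B s‖ = 1)
    (hTN : ∀ s, ⟪T s, N s⟫ = 0) (hTB : ∀ s, ⟪T s, B s⟫ = 0)
    (hNB : ∀ s, ⟪N s, B s⟫ = 0)
    (hT' : ∀ s, deriv T s = κ s • N s)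
    (hN' : ∀ s, deriv N s = (-κ s) • T s + τ s • B s)
    (hB' : ∀ s, deriv B s = (-τ s) • N s)
    (hrpos : ∀ s, 0 < r s) (hr1 : ∀ s, |deriv r s| < 1)
    (R Q : ℝ → ℝ)
    (hR : ∀ s, R s = r s * deriv r s)
    (hQ : ∀ s, Q s = r s * Real.sqrt (1 - (deriv r s) ^ 2))
    (C : ℝ → ℝ → EuclideanSpace ℝ (Fin 3))
    (hC : ∀ s t, C s t = α s - R s • T s - (Q s * Real.cos t) • N s
      + (Q s * Real.sin t) • B s)
    (Cs Ct : ℝ → ℝ → EuclideanSpace ℝ (Fin 3))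
    (hCs : ∀ s t, Cs s t = deriv (fun u => C u t) s)
    (hCt : ∀ s t, Ct s t = deriv (fun u => C s u) t)
    (E F G : ℝ → ℝ → ℝ)
    (hE : ∀ s t, E s t = ⟪Cs s t, Cs s t⟫)
    (hF : ∀ s t, F s t = ⟪Cs s t, Ct s t⟫)
    (hG : ∀ s t, G s t = ⟪Ct s t, Ct s t⟫)
    :
    ∀ s t : ℝ,
      E s t * G s t - F s t ^ 2 =
        Q s ^ 2 * (κ s ^ 2 * (R s ^ 2 + Q s ^ 2) * Real.cos t ^ 2
          + 2 * κ s * (deriv Q s * R s - Q s * deriv R s + Q s) * Real.cos t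
          + 1 - 2 * deriv R s + (deriv R s) ^ 2 + (deriv Q s) ^ 2) := by
  intro s t
  have hrd : Differentiable ℝ r := hr.differentiable (by simp)
  have hr'd : Differentiable ℝ (deriv r) :=
    (contDiff_infty_iff_deriv.mp hr).2.differentiable (by simp)
  have hR' : HasDerivAt R (deriv R s) s := by
    have hfun : R = fun s => r s * deriv r s := funext hR
    exact (hfun ▸ hrd.mul hr'd : Differentiable ℝ R).differentiableAt.hasDerivAt
  have hQ' : HasDerivAt Q (deriv Q s) s := by
    have hfun : Q = fun s => r s * Real.sqrt (1 - (deriv r s) ^ 2) := funext hQ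
    have hne : 1 - (deriv r s) ^ 2 ≠ 0 :=
      (sub_pos.mpr ((sq_lt_one_iff_abs_lt_one _).mpr (hr1 s))).ne'
    have hd : DifferentiableAt ℝ Q s := by
      rw [hfun]
      exact (hrd s).mul ((((hr'd s).pow 2).const_sub 1).sqrt hne)
    exact hd.hasDerivAt
  have hα' : HasDerivAt α (T s) s := by
    rw [hTα]
    exact (hα.differentiable (by simp) s).hasDerivAt
  have hTd : HasDerivAt T (κ s • N s) s := by
    rw [← hT']
    exact (hT.differentiable (by simp) s).hasDerivAt
  have hNd : HasDerivAt N ((-κ s) • T s + τ s • B s) s := by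
    rw [← hN']
    exact (hN.differentiable (by simp) s).hasDerivAt
  have hBd : HasDerivAt B ((-τ s) • N s) s := by
    rw [← hB']
    exact (hB.differentiable (by simp) s).hasDerivAt
  have hCs' : Cs s t = (1 - deriv R s + Q s * κ s * Real.cos t) • T s
      + (-(R s * κ s) - deriv Q s * Real.cos t - Q s * τ s * Real.sin t) • N s
      + (deriv Q s * Real.sin t - Q s * τ s * Real.cos t) • B s := by
    have hfun : (fun u => C u t) = fun u => α u - R u • T u - (Q u * Real.cos t) • N u
        + (Q u * Real.sin t) • B u := funext fun u => hC u t
    rw [hCs, hfun]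
    refine HasDerivAt.deriv ((((hα'.sub (hR'.smul hTd)).sub
      ((hQ'.mul_const (Real.cos t)).smul hNd)).add
      ((hQ'.mul_const (Real.sin t)).smul hBd)).congr_deriv ?_)
    module
  have hCt' : Ct s t = (0 : ℝ) • T s + (Q s * Real.sin t) • N s
      + (Q s * Real.cos t) • B s := by
    have hfun : (fun u => C s u) = fun u => α s - R s • T s - (Q s * Real.cos u) • N s
        + (Q s * Real.sin u) • B s := funext fun u => hC s u
    rw [hCt, hfun]
    refine HasDerivAt.deriv ((((((Real.hasDerivAt_cos t).const_mul (Q s)).smul_const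
      (N s)).const_sub (α s - R s • T s)).add
      (((Real.hasDerivAt_sin t).const_mul (Q s)).smul_const (B s))).congr_deriv ?_)
    module
  rw [hE, hF, hG, hCs', hCt']
  simp only [inner_frame_combination (hT1 s) (hN1 s) (hB1 s) (hTN s) (hTB s) (hNB s)]
  have hcos : Real.cos t ^ 2 = 1 - Real.sin t ^ 2 := Real.cos_sq' t
  grind
end

section
/- For the canal surface C, the coefficients of the second fundamental form are given for every (s,t) by e = −(1/r)·{ Q²κ²cos²(t) + (2RQ′ − 2QR′ + Q)κcos(t) − QQ″ + R²κ² − RR″ + Q²τ² + 2RQκτ·sin(t) }, f = (1/r)·Q(Rκ·sin(t) + Qτ), and g = −Q²/r, where all functions R, Q, κ, τ, r are evaluated at s. -/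
open scoped RealInnerProductSpace

/-- Derivative of a vector field along a curve, written in a moving frame that satisfies the
Frenet equations. -/
theorem HasDerivAt.frenet_combination {V : Type*} [NormedAddCommGroup V] [NormedSpace ℝ V]
    {T N B : ℝ → V} {x y z : ℝ → ℝ} {k w x' y' z' s : ℝ}
    (hT : HasDerivAt T (k • N s) s) (hN : HasDerivAt N ((-k) • T s + w • B s) s)
    (hB : HasDerivAt B ((-w) • N s) s)
    (hx : HasDerivAt x x' s) (hy : HasDerivAt y y' s) (hz : HasDerivAt z z' s) :
    HasDerivAt (fun u => x u • T u + y u • N u + z u • B u)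
      ((x' - k * y s) • T s + (y' + k * x s - w * z s) • N s + (z' + w * y s) • B s) s := by
  refine (((hx.smul hT).add (hy.smul hN)).add (hz.smul hB)).congr_deriv ?_
  module

/-- Derivative of a linear combination of three fixed vectors. -/
theorem HasDerivAt.combination_const {V : Type*} [NormedAddCommGroup V] [NormedSpace ℝ V]
    (a b c : V) {x y z : ℝ → ℝ} {x' y' z' t : ℝ}
    (hx : HasDerivAt x x' t) (hy : HasDerivAt y y' t) (hz : HasDerivAt z z' t) :
    HasDerivAt (fun u => x u • a + y u • b + z u • c) (x' • a + y' • b + z' • c) t :=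
  ((hx.smul_const a).add (hy.smul_const b)).add (hz.smul_const c)

/-- The inner product of two vectors in coordinates with respect to an orthonormal triple. -/
theorem inner_combination_of_orthonormal {V : Type*} [NormedAddCommGroup V]
    [InnerProductSpace ℝ V] {a b c : V} (ha : ‖a‖ = 1) (hb : ‖b‖ = 1) (hc : ‖c‖ = 1)
    (hab : ⟪a, b⟫ = 0) (hac : ⟪a, c⟫ = 0) (hbc : ⟪b, c⟫ = 0) (x y z x' y' z' : ℝ) :
    ⟪x • a + y • b + z • c, x' • a + y' • b + z' • c⟫ = x * x' + y * y' + z * z' := by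
  have hba : ⟪b, a⟫ = 0 := by rw [real_inner_comm, hab]
  have hca : ⟪c, a⟫ = 0 := by rw [real_inner_comm, hac]
  have hcb : ⟪c, b⟫ = 0 := by rw [real_inner_comm, hbc]
  simp only [inner_add_left, inner_add_right, real_inner_smul_left, real_inner_smul_right,
    real_inner_self_eq_norm_sq, ha, hb, hc, hab, hac, hbc, hba, hca, hcb]
  ring

theorem canal_second_fundamental_form
    (α T N B : ℝ → EuclideanSpace ℝ (Fin 3)) (κ τ r : ℝ → ℝ)
    (hα : ContDiff ℝ (⊤ : ℕ∞) α) (hT : ContDiff ℝ (⊤ : ℕ∞) T)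
    (hN : ContDiff ℝ (⊤ : ℕ∞) N) (hB : ContDiff ℝ (⊤ : ℕ∞) B)
    (hκ : ContDiff ℝ (⊤ : ℕ∞) κ) (hτ : ContDiff ℝ (⊤ : ℕ∞) τ)
    (hr : ContDiff ℝ (⊤ : ℕ∞) r)
    (hTα : ∀ s, T s = deriv α s)
    (hT1 : ∀ s, ‖T s‖ = 1) (hN1 : ∀ s, ‖N s‖ = 1) (hB1 : ∀ s, ‖B s‖ = 1)
    (hTN : ∀ s, ⟪T s, N s⟫ = 0) (hTB : ∀ s, ⟪T s, B s⟫ = 0)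
    (hNB : ∀ s, ⟪N s, B s⟫ = 0)
    (hT' : ∀ s, deriv T s = κ s • N s)
    (hN' : ∀ s, deriv N s = (-κ s) • T s + τ s • B s)
    (hB' : ∀ s, deriv B s = (-τ s) • N s)
    (hrpos : ∀ s, 0 < r s) (hr1 : ∀ s, |deriv r s| < 1)
    (R Q : ℝ → ℝ)
    (hR : ∀ s, R s = r s * deriv r s)
    (hQ : ∀ s, Q s = r s * Real.sqrt (1 - (deriv r s) ^ 2))
    (C : ℝ → ℝ → EuclideanSpace ℝ (Fin 3))
    (hC : ∀ s t, C s t = α s - R s • T s - (Q s * Real.cos t) • N s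
      + (Q s * Real.sin t) • B s)
    (Cs Ct : ℝ → ℝ → EuclideanSpace ℝ (Fin 3))
    (hCs : ∀ s t, Cs s t = deriv (fun u => C u t) s)
    (hCt : ∀ s t, Ct s t = deriv (fun u => C s u) t)
    (E F G : ℝ → ℝ → ℝ)
    (hE : ∀ s t, E s t = ⟪Cs s t, Cs s t⟫)
    (hF : ∀ s t, F s t = ⟪Cs s t, Ct s t⟫)
    (hG : ∀ s t, G s t = ⟪Ct s t, Ct s t⟫)
    (n : ℝ → ℝ → EuclideanSpace ℝ (Fin 3))
    (hn : ∀ s t, n s t = (r s)⁻¹ • (C s t - α s))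
    (Css Cst Ctt : ℝ → ℝ → EuclideanSpace ℝ (Fin 3))
    (hCss : ∀ s t, Css s t = deriv (fun u => Cs u t) s)
    (hCst : ∀ s t, Cst s t = deriv (fun u => Cs s u) t)
    (hCtt : ∀ s t, Ctt s t = deriv (fun u => Ct s u) t)
    (e f g : ℝ → ℝ → ℝ)
    (he : ∀ s t, e s t = ⟪Css s t, n s t⟫)
    (hf : ∀ s t, f s t = ⟪Cst s t, n s t⟫)
    (hg : ∀ s t, g s t = ⟪Ctt s t, n s t⟫)
    :
    ∀ s t : ℝ,
      e s t = -(1 / r s) * (Q s ^ 2 * κ s ^ 2 * Real.cos t ^ 2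
          + (2 * R s * deriv Q s - 2 * Q s * deriv R s + Q s) * κ s * Real.cos t
          - Q s * deriv (deriv Q) s + R s ^ 2 * κ s ^ 2 - R s * deriv (deriv R) s
          + Q s ^ 2 * τ s ^ 2 + 2 * R s * Q s * κ s * τ s * Real.sin t) ∧
        f s t = (1 / r s) * (Q s * (R s * κ s * Real.sin t + Q s * τ s)) ∧
        g s t = -(Q s ^ 2) / r s := by
  have hone : ((⊤ : ℕ∞) : WithTop ℕ∞) ≠ 0 := by simp
  have contDiff_deriv {h : ℝ → ℝ} (hh : ContDiff ℝ (⊤ : ℕ∞) h) :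
      ContDiff ℝ (⊤ : ℕ∞) (deriv h) := (contDiff_infty_iff_deriv.1 hh).2
  have hasDeriv {h : ℝ → ℝ} (hh : ContDiff ℝ (⊤ : ℕ∞) h) (s : ℝ) :
      HasDerivAt h (deriv h s) s := (hh.differentiable hone s).hasDerivAt
  have hrd := contDiff_deriv hr
  have hRs : ContDiff ℝ (⊤ : ℕ∞) R := by
    rw [funext hR]
    exact hr.mul hrd
  have hQs : ContDiff ℝ (⊤ : ℕ∞) Q := by
    rw [funext hQ]
    refine hr.mul ((contDiff_const.sub (hrd.pow 2)).sqrt fun s => ?_)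
    have := (sq_lt_one_iff_abs_lt_one _).2 (hr1 s)
    linarith
  have dα (s : ℝ) : HasDerivAt α (T s) s := by
    rw [hTα s]
    exact (hα.differentiable hone s).hasDerivAt
  have dT (s : ℝ) : HasDerivAt T (κ s • N s) s := by
    rw [← hT' s]
    exact (hT.differentiable hone s).hasDerivAt
  have dN (s : ℝ) : HasDerivAt N ((-κ s) • T s + τ s • B s) s := by
    rw [← hN' s]
    exact (hN.differentiable hone s).hasDerivAt
  have dB (s : ℝ) : HasDerivAt B ((-τ s) • N s) s := by
    rw [← hB' s]
    exact (hB.differentiable hone s).hasDerivAt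
  have dR := hasDeriv hRs
  have dQ := hasDeriv hQs
  have dR' := hasDeriv (contDiff_deriv hRs)
  have dQ' := hasDeriv (contDiff_deriv hQs)
  have dκ := hasDeriv hκ
  have dτ := hasDeriv hτ
  have dcos (c t : ℝ) : HasDerivAt (fun u => c * Real.cos u) (c * -Real.sin t) t :=
    (Real.hasDerivAt_cos t).const_mul c
  have dsin (c t : ℝ) : HasDerivAt (fun u => c * Real.sin u) (c * Real.cos t) t :=
    (Real.hasDerivAt_sin t).const_mul c
  have C_eq (s t : ℝ) : C s t = α s +
      ((-R s) • T s + (-(Q s * Real.cos t)) • N s + (Q s * Real.sin t) • B s) := by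
    rw [hC]
    module
  have n_eq (s t : ℝ) : n s t = (-R s / r s) • T s + (-(Q s * Real.cos t) / r s) • N s
      + (Q s * Real.sin t / r s) • B s := by
    rw [hn, C_eq]
    module
  have Cs_eq (s t : ℝ) : Cs s t =
      (1 - deriv R s + κ s * (Q s * Real.cos t)) • T s
      + (-(deriv Q s * Real.cos t) - κ s * R s - τ s * (Q s * Real.sin t)) • N s
      + (deriv Q s * Real.sin t - τ s * (Q s * Real.cos t)) • B s := by
    rw [hCs, funext fun u => C_eq u t]
    refine ((dα s).add ((dT s).frenet_combination (dN s) (dB s) (dR s).neg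
      ((dQ s).mul_const (Real.cos t)).neg ((dQ s).mul_const (Real.sin t)))).deriv.trans ?_
    simp only [Pi.neg_apply]
    module
  have Ct_eq (s t : ℝ) : Ct s t =
      (0 : ℝ) • T s + (Q s * Real.sin t) • N s + (Q s * Real.cos t) • B s := by
    rw [hCt, funext fun u => C_eq s u]
    refine ((HasDerivAt.combination_const (T s) (N s) (B s) (hasDerivAt_const t (-R s))
      (dcos (Q s) t).neg (dsin (Q s) t)).const_add (α s)).deriv.trans ?_
    module
  have inner_eq (s : ℝ) := inner_combination_of_orthonormal (hT1 s) (hN1 s) (hB1 s)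
    (hTN s) (hTB s) (hNB s)
  intro s t
  have hr0 : r s ≠ 0 := (hrpos s).ne'
  have hcs : Real.sin t ^ 2 = 1 - Real.cos t ^ 2 := Real.sin_sq t
  refine ⟨?_, ?_, ?_⟩
  · have dQc := (dQ s).mul_const (Real.cos t)
    have dQs := (dQ s).mul_const (Real.sin t)
    rw [he, hCss, funext fun u => Cs_eq u t,
      ((dT s).frenet_combination (dN s) (dB s)
        (((dR' s).const_sub 1).fun_add ((dκ s).fun_mul dQc))
        ((((dQ' s).mul_const (Real.cos t)).fun_neg.fun_sub ((dκ s).fun_mul (dR s))).fun_sub ((dτ s).fun_mul dQs))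
        (((dQ' s).mul_const (Real.sin t)).fun_sub ((dτ s).fun_mul dQc))).deriv,
      n_eq, inner_eq]
    field_simp
    ring_nf
    simp only [hcs]
    ring
  · rw [hf, hCst, funext fun u => Cs_eq s u,
      (HasDerivAt.combination_const (T s) (N s) (B s)
        (((dcos (Q s) t).const_mul (κ s)).const_add (1 - deriv R s))
        (((dcos (deriv Q s) t).fun_neg.sub_const (κ s * R s)).fun_sub
          ((dsin (Q s) t).const_mul (τ s)))
        ((dsin (deriv Q s) t).fun_sub ((dcos (Q s) t).const_mul (τ s)))).deriv,
      n_eq, inner_eq]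
    field_simp
    ring_nf
    simp only [hcs]
    ring
  · rw [hg, hCtt, funext fun u => Ct_eq s u,
      (HasDerivAt.combination_const (T s) (N s) (B s) (hasDerivAt_const t 0)
        (dsin (Q s) t) (dcos (Q s) t)).deriv,
      n_eq, inner_eq]
    field_simp
    ring_nf
    simp only [hcs]
    ring
end

section
/- For the canal surface C, at every point (s,t) where (EG − F²)(s,t) ≠ 0, the Gaussian curvature satisfies K(s,t) = (Q²/(r²·(EG − F²)))·{ κ²(R² + Q²)cos²(t) + κ(2Q′R − 2QR′ + Q)cos(t) − (RR″ + QQ″) }, where all functions R, Q, κ, r are evaluated at s. -/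
open scoped RealInnerProductSpace

/-- If two differentiable curves are pointwise orthogonal, then `⟪u', v⟫ = -⟪u, v'⟫`. -/
theorem inner_deriv_left_eq_neg_of_inner_eq_zero {V : Type*} [NormedAddCommGroup V]
    [InnerProductSpace ℝ V] {u v : ℝ → V} (huv : ∀ x, ⟪u x, v x⟫ = 0) {x : ℝ} {u' v' : V}
    (hu : HasDerivAt u u' x) (hv : HasDerivAt v v' x) : ⟪u', v x⟫ = -⟪u x, v'⟫ := by
  have h := hu.inner ℝ hv
  simp only [huv] at h
  linarith [h.unique (hasDerivAt_const x (0 : ℝ))]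

theorem canal_gaussian_curvature
    (α T N B : ℝ → EuclideanSpace ℝ (Fin 3)) (κ τ r : ℝ → ℝ)
    (hα : ContDiff ℝ (⊤ : ℕ∞) α) (hT : ContDiff ℝ (⊤ : ℕ∞) T)
    (hN : ContDiff ℝ (⊤ : ℕ∞) N) (hB : ContDiff ℝ (⊤ : ℕ∞) B)
    (hκ : ContDiff ℝ (⊤ : ℕ∞) κ) (hτ : ContDiff ℝ (⊤ : ℕ∞) τ)
    (hr : ContDiff ℝ (⊤ : ℕ∞) r)
    (hTα : ∀ s, T s = deriv α s)
    (hT1 : ∀ s, ‖T s‖ = 1) (hN1 : ∀ s, ‖N s‖ = 1) (hB1 : ∀ s, ‖B s‖ = 1)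
    (hTN : ∀ s, ⟪T s, N s⟫ = 0) (hTB : ∀ s, ⟪T s, B s⟫ = 0)
    (hNB : ∀ s, ⟪N s, B s⟫ = 0)
    (hT' : ∀ s, deriv T s = κ s • N s)
    (hN' : ∀ s, deriv N s = (-κ s) • T s + τ s • B s)
    (hB' : ∀ s, deriv B s = (-τ s) • N s)
    (hrpos : ∀ s, 0 < r s) (hr1 : ∀ s, |deriv r s| < 1)
    (R Q : ℝ → ℝ)
    (hR : ∀ s, R s = r s * deriv r s)
    (hQ : ∀ s, Q s = r s * Real.sqrt (1 - (deriv r s) ^ 2))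
    (C : ℝ → ℝ → EuclideanSpace ℝ (Fin 3))
    (hC : ∀ s t, C s t = α s - R s • T s - (Q s * Real.cos t) • N s
      + (Q s * Real.sin t) • B s)
    (Cs Ct : ℝ → ℝ → EuclideanSpace ℝ (Fin 3))
    (hCs : ∀ s t, Cs s t = deriv (fun u => C u t) s)
    (hCt : ∀ s t, Ct s t = deriv (fun u => C s u) t)
    (E F G : ℝ → ℝ → ℝ)
    (hE : ∀ s t, E s t = ⟪Cs s t, Cs s t⟫)
    (hF : ∀ s t, F s t = ⟪Cs s t, Ct s t⟫)
    (hG : ∀ s t, G s t = ⟪Ct s t, Ct s t⟫)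
    (n : ℝ → ℝ → EuclideanSpace ℝ (Fin 3))
    (hn : ∀ s t, n s t = (r s)⁻¹ • (C s t - α s))
    (Css Cst Ctt : ℝ → ℝ → EuclideanSpace ℝ (Fin 3))
    (hCss : ∀ s t, Css s t = deriv (fun u => Cs u t) s)
    (hCst : ∀ s t, Cst s t = deriv (fun u => Cs s u) t)
    (hCtt : ∀ s t, Ctt s t = deriv (fun u => Ct s u) t)
    (e f g : ℝ → ℝ → ℝ)
    (he : ∀ s t, e s t = ⟪Css s t, n s t⟫)
    (hf : ∀ s t, f s t = ⟪Cst s t, n s t⟫)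
    (hg : ∀ s t, g s t = ⟪Ctt s t, n s t⟫)
    (K : ℝ → ℝ → ℝ)
    (hK : ∀ s t, K s t = (e s t * g s t - f s t ^ 2) / (E s t * G s t - F s t ^ 2))
    :
    ∀ s t : ℝ, E s t * G s t - F s t ^ 2 ≠ 0 →
      K s t = Q s ^ 2 / (r s ^ 2 * (E s t * G s t - F s t ^ 2)) *
        (κ s ^ 2 * (R s ^ 2 + Q s ^ 2) * Real.cos t ^ 2
          + κ s * (2 * deriv Q s * R s - 2 * Q s * deriv R s + Q s) * Real.cos t
          - (R s * deriv (deriv R) s + Q s * deriv (deriv Q) s)) := by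
  have hDα : ∀ s, HasDerivAt α (T s) s := fun s => by
    rw [hTα]; exact (hα.differentiable (by simp) s).hasDerivAt
  have hDT : ∀ s, HasDerivAt T (κ s • N s) s := fun s => by
    rw [← hT']; exact (hT.differentiable (by simp) s).hasDerivAt
  have hDN : ∀ s, HasDerivAt N ((-κ s) • T s + τ s • B s) s := fun s => by
    rw [← hN']; exact (hN.differentiable (by simp) s).hasDerivAt
  have hDB : ∀ s, HasDerivAt B ((-τ s) • N s) s := fun s => by
    rw [← hB']; exact (hB.differentiable (by simp) s).hasDerivAt
  have hr' : ContDiff ℝ (⊤ : ℕ∞) (deriv r) := (contDiff_infty_iff_deriv.1 hr).2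
  have hpos : ∀ s, 0 < 1 - deriv r s ^ 2 := fun s => by
    have := (sq_lt_one_iff_abs_lt_one (deriv r s)).2 (hr1 s)
    linarith
  have hRsm : ContDiff ℝ (⊤ : ℕ∞) R := by
    rw [funext hR]; exact hr.mul hr'
  have hQsm : ContDiff ℝ (⊤ : ℕ∞) Q := by
    rw [funext hQ]
    exact hr.mul ((contDiff_const.sub (hr'.pow 2)).sqrt fun s => (hpos s).ne')
  have hDr : ∀ s, HasDerivAt r (deriv r s) s := fun s =>
    (hr.differentiable (by simp) s).hasDerivAt
  have hDR : ∀ s, HasDerivAt R (deriv R s) s := fun s =>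
    (hRsm.differentiable (by simp) s).hasDerivAt
  have hDQ : ∀ s, HasDerivAt Q (deriv Q s) s := fun s =>
    (hQsm.differentiable (by simp) s).hasDerivAt
  have hDR' : ∀ s, HasDerivAt (deriv R) (deriv (deriv R) s) s := fun s =>
    ((contDiff_infty_iff_deriv.1 hRsm).2.differentiable (by simp) s).hasDerivAt
  have hDQ' : ∀ s, HasDerivAt (deriv Q) (deriv (deriv Q) s) s := fun s =>
    ((contDiff_infty_iff_deriv.1 hQsm).2.differentiable (by simp) s).hasDerivAt
  have hsum : ∀ s, R s * R s + Q s * Q s = r s * r s := fun s => by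
    rw [hR, hQ]
    linear_combination r s ^ 2 * Real.sq_sqrt (hpos s).le
  have hsum' : ∀ s, R s * deriv R s + Q s * deriv Q s = R s := fun s => by
    have h := ((hDR s).mul (hDR s)).add ((hDQ s).mul (hDQ s))
    have h' := (hDr s).mul (hDr s)
    have heq : R * R + Q * Q = r * r := funext hsum
    rw [heq] at h
    linarith [h.unique h', hR s]
  have hsum'' : ∀ s, deriv R s ^ 2 + R s * deriv (deriv R) s
      + (deriv Q s ^ 2 + Q s * deriv (deriv Q) s) = deriv R s := fun s => by
    have h := ((hDR s).mul (hDR' s)).add ((hDQ s).mul (hDQ' s))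
    have heq : R * deriv R + Q * deriv Q = R := funext hsum'
    rw [heq] at h
    linarith [h.unique (hDR s)]
  have hDCs : ∀ s t, HasDerivAt (fun u => C u t) (Cs s t) s := fun s t => by
    rw [hCs]
    apply DifferentiableAt.hasDerivAt
    simp only [hC]
    have := (hDα s).differentiableAt
    have := (hDT s).differentiableAt
    have := (hDN s).differentiableAt
    have := (hDB s).differentiableAt
    have := (hDR s).differentiableAt
    have := (hDQ s).differentiableAt
    fun_prop
  have hCs_eq : ∀ s t, Cs s t = (1 - deriv R s + κ s * Q s * Real.cos t) • T s
      + (-(R s * κ s) - deriv Q s * Real.cos t - τ s * Q s * Real.sin t) • N s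
      + (deriv Q s * Real.sin t - τ s * Q s * Real.cos t) • B s := fun s t => by
    have h := (((hDα s).sub ((hDR s).smul (hDT s))).sub
      (((hDQ s).mul_const (Real.cos t)).smul (hDN s))).add
      (((hDQ s).mul_const (Real.sin t)).smul (hDB s))
    have hfun : (fun u => C u t) = _ := funext fun u => hC u t
    have hD := hDCs s t
    rw [hfun] at hD
    rw [hD.unique h]
    module
  have hCt_eq : ∀ s t, Ct s t = (Q s * Real.sin t) • N s + (Q s * Real.cos t) • B s :=
    fun s t => by
    have h := (((hasDerivAt_const t (α s - R s • T s)).sub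
      (((Real.hasDerivAt_cos t).const_mul (Q s)).smul_const (N s))).add
      (((Real.hasDerivAt_sin t).const_mul (Q s)).smul_const (B s)))
    have hfun : (fun u => C s u) = _ := funext fun u => hC s u
    rw [hCt, hfun]
    refine (HasDerivAt.deriv h).trans ?_
    module
  have hDCt : ∀ s t, HasDerivAt (fun u => C s u) (Ct s t) t := fun s t => by
    rw [hCt]
    apply DifferentiableAt.hasDerivAt
    simp only [hC]
    fun_prop
  have hDCss : ∀ s t, HasDerivAt (fun u => Cs u t) (Css s t) s := fun s t => by
    rw [hCss]
    apply DifferentiableAt.hasDerivAt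
    simp only [hCs_eq]
    have := (hDT s).differentiableAt
    have := (hDN s).differentiableAt
    have := (hDB s).differentiableAt
    have := (hDR s).differentiableAt
    have := (hDQ s).differentiableAt
    have := (hDR' s).differentiableAt
    have := (hDQ' s).differentiableAt
    have := hκ.differentiable (by simp) s
    have := hτ.differentiable (by simp) s
    fun_prop
  have hDCst : ∀ s t, HasDerivAt (fun u => Cs s u) (Cst s t) t := fun s t => by
    rw [hCst]
    apply DifferentiableAt.hasDerivAt
    simp only [hCs_eq]
    fun_prop
  have hDCtt : ∀ s t, HasDerivAt (fun u => Ct s u) (Ctt s t) t := fun s t => by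
    rw [hCtt]
    apply DifferentiableAt.hasDerivAt
    simp only [hCt_eq]
    fun_prop
  have hTT : ∀ s, ⟪T s, T s⟫ = 1 := fun s => by simp [hT1]
  have hNN : ∀ s, ⟪N s, N s⟫ = 1 := fun s => by simp [hN1]
  have hBB : ∀ s, ⟪B s, B s⟫ = 1 := fun s => by simp [hB1]
  have hframe : ∀ s (a b c x y z : ℝ),
      ⟪a • T s + b • N s + c • B s, x • T s + y • N s + z • B s⟫ = a * x + b * y + c * z :=
    fun s a b c x y z => by
    have hNT := (real_inner_comm (T s) (N s)).trans (hTN s)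
    have hBT := (real_inner_comm (T s) (B s)).trans (hTB s)
    have hBN := (real_inner_comm (N s) (B s)).trans (hNB s)
    simp only [inner_add_left, inner_add_right, real_inner_smul_left, real_inner_smul_right,
      hTT, hNN, hBB, hTN, hTB, hNB, hNT, hBT, hBN]
    ring
  have hX : ∀ s t, C s t - α s
      = (-R s) • T s + (-(Q s * Real.cos t)) • N s + (Q s * Real.sin t) • B s := fun s t => by
    rw [hC]; module
  have hCt_frame : ∀ s t, Ct s t
      = (0 : ℝ) • T s + (Q s * Real.sin t) • N s + (Q s * Real.cos t) • B s := fun s t => by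
    rw [hCt_eq]; module
  have hCsX : ∀ s t, ⟪Cs s t, C s t - α s⟫ = 0 := fun s t => by
    rw [hCs_eq, hX, hframe]
    linear_combination hsum' s + Q s * deriv Q s * Real.sin_sq_add_cos_sq t
  have hCtX : ∀ s t, ⟪Ct s t, C s t - α s⟫ = 0 := fun s t => by
    rw [hCt_frame, hX, hframe]
    ring
  intro s t _
  have hr0 : r s ≠ 0 := (hrpos s).ne'
  have hCsT : ⟪Cs s t, T s⟫ = 1 - deriv R s + κ s * Q s * Real.cos t := by
    have h := hframe s (1 - deriv R s + κ s * Q s * Real.cos t)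
      (-(R s * κ s) - deriv Q s * Real.cos t - τ s * Q s * Real.sin t)
      (deriv Q s * Real.sin t - τ s * Q s * Real.cos t) 1 0 0
    rw [← hCs_eq] at h
    simpa using h
  have he' : e s t = -(r s)⁻¹ * (E s t - (1 - deriv R s + κ s * Q s * Real.cos t)) := by
    have h := inner_deriv_left_eq_neg_of_inner_eq_zero (fun u => hCsX u t)
      (hDCss s t) ((hDCs s t).sub (hDα s))
    rw [inner_sub_right (Cs s t), hCsT, ← hE] at h
    rw [he, hn, real_inner_smul_right, h]
    ring
  have hf' : f s t = -(r s)⁻¹ * F s t := by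
    have h := inner_deriv_left_eq_neg_of_inner_eq_zero (hCsX s)
      (hDCst s t) ((hDCt s t).sub_const (α s))
    rw [← hF] at h
    rw [hf, hn, real_inner_smul_right, h]
    ring
  have hg' : g s t = -(r s)⁻¹ * G s t := by
    have h := inner_deriv_left_eq_neg_of_inner_eq_zero (hCtX s)
      (hDCtt s t) ((hDCt s t).sub_const (α s))
    rw [← hG] at h
    rw [hg, hn, real_inner_smul_right, h]
    ring
  have hG_eq : G s t = Q s ^ 2 := by
    rw [hG, hCt_frame, hframe]
    linear_combination Q s ^ 2 * Real.sin_sq_add_cos_sq t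
  have hdet : E s t * G s t - F s t ^ 2 = Q s ^ 2 *
      ((1 - deriv R s + κ s * Q s * Real.cos t) ^ 2
        + (R s * κ s * Real.cos t + deriv Q s) ^ 2) := by
    rw [hG_eq, hE, hF, hCt_frame, hCs_eq, hframe, hframe]
    have hsin : Real.sin t ^ 2 = 1 - Real.cos t ^ 2 := Real.sin_sq t
    grind
  have hnum : r s ^ 2 * (e s t * g s t - f s t ^ 2) = Q s ^ 2 *
      (κ s ^ 2 * (R s ^ 2 + Q s ^ 2) * Real.cos t ^ 2
        + κ s * (2 * deriv Q s * R s - 2 * Q s * deriv R s + Q s) * Real.cos t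
        - (R s * deriv (deriv R) s + Q s * deriv (deriv Q) s)) := by
    have h : r s ^ 2 * (e s t * g s t - f s t ^ 2) = (E s t * G s t - F s t ^ 2)
        - (1 - deriv R s + κ s * Q s * Real.cos t) * G s t := by
      rw [he', hf', hg']
      field_simp
      ring
    rw [h, hdet, hG_eq]
    linear_combination Q s ^ 2 * hsum'' s
  rw [hK, div_mul_eq_mul_div, ← hnum]
  exact (mul_div_mul_left _ _ (pow_ne_zero 2 hr0)).symm
end

section
/- Every tubular surface is a (H,K)-Weingarten canal surface: if the radius function r is constant (r′(s) = 0 for all s) and (EG − F²)(s,t) ≠ 0 for all (s,t), then the Jacobi equation Φ(H,K) = H_t·K_s − H_s·K_t = 0 holds at every point (s,t). -/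
open scoped RealInnerProductSpace

/-- The inner product of two vectors in terms of their coordinates in an orthonormal frame. -/
theorem inner_frame_combination_s6 {V : Type*} [NormedAddCommGroup V] [InnerProductSpace ℝ V]
    {T N B : V} (hT : ‖T‖ = 1) (hN : ‖N‖ = 1) (hB : ‖B‖ = 1)
    (hTN : ⟪T, N⟫ = 0) (hTB : ⟪T, B⟫ = 0) (hNB : ⟪N, B⟫ = 0) (x y z x' y' z' : ℝ) :
    ⟪x • T + y • N + z • B, x' • T + y' • N + z' • B⟫ = x * x' + y * y' + z * z' := by
  have hNT : ⟪N, T⟫ = 0 := by rw [real_inner_comm, hTN]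
  have hBT : ⟪B, T⟫ = 0 := by rw [real_inner_comm, hTB]
  have hBN : ⟪B, N⟫ = 0 := by rw [real_inner_comm, hNB]
  simp only [inner_add_left, inner_add_right, real_inner_smul_left, real_inner_smul_right,
    real_inner_self_eq_norm_sq, hT, hN, hB, hTN, hTB, hNB, hNT, hBT, hBN]
  ring

/-- The derivative of a vector field along a curve, in coordinates in a Frenet frame. -/
theorem hasDerivAt_frenet_combination {V : Type*} [NormedAddCommGroup V] [NormedSpace ℝ V]
    {T N B : ℝ → V} {x y z : ℝ → ℝ} {κ τ x' y' z' s : ℝ}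
    (hT : HasDerivAt T (κ • N s) s) (hN : HasDerivAt N ((-κ) • T s + τ • B s) s)
    (hB : HasDerivAt B ((-τ) • N s) s)
    (hx : HasDerivAt x x' s) (hy : HasDerivAt y y' s) (hz : HasDerivAt z z' s) :
    HasDerivAt (fun u => x u • T u + y u • N u + z u • B u)
      ((x' - κ * y s) • T s + (y' + κ * x s - τ * z s) • N s + (z' + τ * y s) • B s) s := by
  refine (((hx.smul hT).add (hy.smul hN)).add (hz.smul hB)).congr_deriv ?_
  module

/-- The derivative of a vector with variable coordinates in a fixed frame. -/
theorem hasDerivAt_linear_combination {V : Type*} [NormedAddCommGroup V] [NormedSpace ℝ V]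
    (T N B : V) {x y z : ℝ → ℝ} {x' y' z' t : ℝ}
    (hx : HasDerivAt x x' t) (hy : HasDerivAt y y' t) (hz : HasDerivAt z z' t) :
    HasDerivAt (fun u => x u • T + y u • N + z u • B) (x' • T + y' • N + z' • B) t :=
  ((hx.smul_const T).add (hy.smul_const N)).add (hz.smul_const B)

/-- Two functions related by an affine function have vanishing Jacobian. -/
theorem jacobian_eq_zero_of_affine {H K : ℝ → ℝ → ℝ} {a b : ℝ}
    (h : ∀ s t, H s t = a + b * K s t) (s t : ℝ) :
    deriv (fun u => H s u) t * deriv (fun u => K u t) s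
      - deriv (fun u => H u t) s * deriv (fun u => K s u) t = 0 := by
  simp only [h, deriv_const_add, deriv_const_mul_field]
  ring

theorem tube_is_HK_Weingarten
    (α T N B : ℝ → EuclideanSpace ℝ (Fin 3)) (κ τ r : ℝ → ℝ)
    (hα : ContDiff ℝ (⊤ : ℕ∞) α) (hT : ContDiff ℝ (⊤ : ℕ∞) T)
    (hN : ContDiff ℝ (⊤ : ℕ∞) N) (hB : ContDiff ℝ (⊤ : ℕ∞) B)
    (hκ : ContDiff ℝ (⊤ : ℕ∞) κ) (hτ : ContDiff ℝ (⊤ : ℕ∞) τ)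
    (hr : ContDiff ℝ (⊤ : ℕ∞) r)
    (hTα : ∀ s, T s = deriv α s)
    (hT1 : ∀ s, ‖T s‖ = 1) (hN1 : ∀ s, ‖N s‖ = 1) (hB1 : ∀ s, ‖B s‖ = 1)
    (hTN : ∀ s, ⟪T s, N s⟫ = 0) (hTB : ∀ s, ⟪T s, B s⟫ = 0)
    (hNB : ∀ s, ⟪N s, B s⟫ = 0)
    (hT' : ∀ s, deriv T s = κ s • N s)
    (hN' : ∀ s, deriv N s = (-κ s) • T s + τ s • B s)
    (hB' : ∀ s, deriv B s = (-τ s) • N s)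
    (hrpos : ∀ s, 0 < r s) (hr1 : ∀ s, |deriv r s| < 1)
    (R Q : ℝ → ℝ)
    (hR : ∀ s, R s = r s * deriv r s)
    (hQ : ∀ s, Q s = r s * Real.sqrt (1 - (deriv r s) ^ 2))
    (C : ℝ → ℝ → EuclideanSpace ℝ (Fin 3))
    (hC : ∀ s t, C s t = α s - R s • T s - (Q s * Real.cos t) • N s
      + (Q s * Real.sin t) • B s)
    (Cs Ct : ℝ → ℝ → EuclideanSpace ℝ (Fin 3))
    (hCs : ∀ s t, Cs s t = deriv (fun u => C u t) s)
    (hCt : ∀ s t, Ct s t = deriv (fun u => C s u) t)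
    (E F G : ℝ → ℝ → ℝ)
    (hE : ∀ s t, E s t = ⟪Cs s t, Cs s t⟫)
    (hF : ∀ s t, F s t = ⟪Cs s t, Ct s t⟫)
    (hG : ∀ s t, G s t = ⟪Ct s t, Ct s t⟫)
    (n : ℝ → ℝ → EuclideanSpace ℝ (Fin 3))
    (hn : ∀ s t, n s t = (r s)⁻¹ • (C s t - α s))
    (Css Cst Ctt : ℝ → ℝ → EuclideanSpace ℝ (Fin 3))
    (hCss : ∀ s t, Css s t = deriv (fun u => Cs u t) s)
    (hCst : ∀ s t, Cst s t = deriv (fun u => Cs s u) t)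
    (hCtt : ∀ s t, Ctt s t = deriv (fun u => Ct s u) t)
    (e f g : ℝ → ℝ → ℝ)
    (he : ∀ s t, e s t = ⟪Css s t, n s t⟫)
    (hf : ∀ s t, f s t = ⟪Cst s t, n s t⟫)
    (hg : ∀ s t, g s t = ⟪Ctt s t, n s t⟫)
    (K : ℝ → ℝ → ℝ)
    (hK : ∀ s t, K s t = (e s t * g s t - f s t ^ 2) / (E s t * G s t - F s t ^ 2))
    (H : ℝ → ℝ → ℝ)
    (hH : ∀ s t, H s t = (E s t * g s t - 2 * F s t * f s t + G s t * e s t)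
      / (2 * (E s t * G s t - F s t ^ 2)))
    (Ks Kt : ℝ → ℝ → ℝ)
    (hKs : ∀ s t, Ks s t = deriv (fun u => K u t) s)
    (hKt : ∀ s t, Kt s t = deriv (fun u => K s u) t)
    (Hs Ht : ℝ → ℝ → ℝ)
    (hHs : ∀ s t, Hs s t = deriv (fun u => H u t) s)
    (hHt : ∀ s t, Ht s t = deriv (fun u => H s u) t)
    (hrconst : ∀ s, deriv r s = 0)
    (hreg : ∀ s t, E s t * G s t - F s t ^ 2 ≠ 0)
    :
    ∀ s t : ℝ, Ht s t * Ks s t - Hs s t * Kt s t = 0 := by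
  have dα s : HasDerivAt α (T s) s := by
    rw [hTα]; exact (hα.differentiable (by simp) s).hasDerivAt
  have dT s : HasDerivAt T (κ s • N s) s := by
    rw [← hT']; exact (hT.differentiable (by simp) s).hasDerivAt
  have dN s : HasDerivAt N ((-κ s) • T s + τ s • B s) s := by
    rw [← hN']; exact (hN.differentiable (by simp) s).hasDerivAt
  have dB s : HasDerivAt B ((-τ s) • N s) s := by
    rw [← hB']; exact (hB.differentiable (by simp) s).hasDerivAt
  have dκ s : HasDerivAt κ (deriv κ s) s := (hκ.differentiable (by simp) s).hasDerivAt
  have dτ s : HasDerivAt τ (deriv τ s) s := (hτ.differentiable (by simp) s).hasDerivAt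
  obtain ⟨c, hc⟩ : ∃ c, ∀ s, r s = c :=
    ⟨r 0, fun s => is_const_of_deriv_eq_zero (hr.differentiable (by simp)) hrconst s 0⟩
  have hc0 : c ≠ 0 := hc 0 ▸ (hrpos 0).ne'
  have inner_frame (s : ℝ) :=
    inner_frame_combination_s6 (hT1 s) (hN1 s) (hB1 s) (hTN s) (hTB s) (hNB s)
  have C_eq s t : C s t = α s
      + ((0 : ℝ) • T s + (-(c * Real.cos t)) • N s + (c * Real.sin t) • B s) := by
    simp only [hC, hR, hQ, hrconst, hc]
    norm_num
    module
  have n_eq s t : n s t = (0 : ℝ) • T s + (-Real.cos t) • N s + Real.sin t • B s := by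
    rw [hn, C_eq, hc, add_sub_cancel_left]
    match_scalars <;> field_simp
    simp
  have Cs_eq s t : Cs s t = (1 + c * κ s * Real.cos t) • T s
      + (-(c * τ s * Real.sin t)) • N s + (-(c * τ s * Real.cos t)) • B s := by
    simp only [hCs, C_eq]
    rw [((dα s).fun_add (hasDerivAt_frenet_combination (dT s) (dN s) (dB s) (hasDerivAt_const s _)
      (hasDerivAt_const s _) (hasDerivAt_const s _))).deriv]
    module
  have Ct_eq s t : Ct s t = (0 : ℝ) • T s + (c * Real.sin t) • N s + (c * Real.cos t) • B s := by
    simp only [hCt, C_eq]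
    rw [((hasDerivAt_linear_combination _ _ _ (hasDerivAt_const t _)
      ((Real.hasDerivAt_cos t).const_mul c).fun_neg
      ((Real.hasDerivAt_sin t).const_mul c)).const_add (α s)).deriv]
    module
  have Ctt_eq s t : Ctt s t =
      (0 : ℝ) • T s + (c * Real.cos t) • N s + (c * -Real.sin t) • B s := by
    simp only [hCtt, Ct_eq]
    exact (hasDerivAt_linear_combination _ _ _ (hasDerivAt_const t _)
      ((Real.hasDerivAt_sin t).const_mul c) ((Real.hasDerivAt_cos t).const_mul c)).deriv
  have Cst_eq s t : Cst s t = (c * κ s * -Real.sin t) • T s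
      + (-(c * τ s * Real.cos t)) • N s + (-(c * τ s * -Real.sin t)) • B s := by
    simp only [hCst, Cs_eq]
    exact (hasDerivAt_linear_combination _ _ _
      (((Real.hasDerivAt_cos t).const_mul (c * κ s)).const_add 1)
      ((Real.hasDerivAt_sin t).const_mul (c * τ s)).fun_neg
      ((Real.hasDerivAt_cos t).const_mul (c * τ s)).fun_neg).deriv
  have Css_eq s t := by
    have h := hCss s t
    simp only [Cs_eq] at h
    rwa [(hasDerivAt_frenet_combination (dT s) (dN s) (dB s)
      ((((dκ s).const_mul c).mul_const (Real.cos t)).const_add 1)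
      (((dτ s).const_mul c).mul_const (Real.sin t)).fun_neg
      (((dτ s).const_mul c).mul_const (Real.cos t)).fun_neg).deriv] at h
  have E_eq s t : E s t = (1 + c * κ s * Real.cos t) ^ 2 + c ^ 2 * τ s ^ 2 := by
    rw [hE, Cs_eq, inner_frame]
    linear_combination c ^ 2 * τ s ^ 2 * Real.sin_sq_add_cos_sq t
  have F_eq s t : F s t = -(c ^ 2 * τ s) := by
    rw [hF, Cs_eq, Ct_eq, inner_frame]
    linear_combination -c ^ 2 * τ s * Real.sin_sq_add_cos_sq t
  have G_eq s t : G s t = c ^ 2 := by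
    rw [hG, Ct_eq, inner_frame]
    linear_combination c ^ 2 * Real.sin_sq_add_cos_sq t
  have e_eq s t : e s t =
      -((1 + c * κ s * Real.cos t) * κ s * Real.cos t) - c * τ s ^ 2 := by
    rw [he, Css_eq, n_eq, inner_frame]
    linear_combination -c * τ s ^ 2 * Real.sin_sq_add_cos_sq t
  have f_eq s t : f s t = c * τ s := by
    rw [hf, Cst_eq, n_eq, inner_frame]
    linear_combination c * τ s * Real.sin_sq_add_cos_sq t
  have g_eq s t : g s t = -c := by
    rw [hg, Ctt_eq, n_eq, inner_frame]
    linear_combination -c * Real.sin_sq_add_cos_sq t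
  have affine s t : H s t = -1 / (2 * c) + -c / 2 * K s t := by
    have hne := hreg s t
    have disc : E s t * G s t - F s t ^ 2 = c ^ 2 * (1 + c * κ s * Real.cos t) ^ 2 := by
      rw [E_eq, F_eq, G_eq]
      ring
    rw [hH, hK, disc, E_eq, F_eq, G_eq, e_eq, f_eq, g_eq]
    rw [disc] at hne
    have ha : 1 + c * κ s * Real.cos t ≠ 0 := fun h => hne (by rw [h]; ring)
    field_simp
    ring
  intro s t
  rw [hHt, hKs, hHs, hKt]
  exact jacobian_eq_zero_of_affine affine s t
end

section
/- Every canal surface of revolution is a (H,K)-Weingarten surface: if the curvature of the center curve vanishes identically (κ(s) = 0 for all s) and (EG − F²)(s,t) ≠ 0 for all (s,t), then the Jacobi equation Φ(H,K) = H_t·K_s − H_s·K_t = 0 holds at every point (s,t). -/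
open scoped RealInnerProductSpace

/-- The vector with coordinates `(a, b, c)` in the orthonormal frame `T`,
`-cos t N + sin t B`, `sin t N + cos t B`. -/
noncomputable def rotatedFrameComb {V : Type*} [AddCommGroup V] [Module ℝ V]
    (T N B : V) (t a b c : ℝ) : V :=
  a • T + (c * Real.sin t - b * Real.cos t) • N + (b * Real.sin t + c * Real.cos t) • B

section RotatedFrame

variable {V : Type*} [NormedAddCommGroup V] [InnerProductSpace ℝ V]

theorem inner_rotatedFrameComb {T N B : V} (hT : ‖T‖ = 1) (hN : ‖N‖ = 1) (hB : ‖B‖ = 1)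
    (hTN : ⟪T, N⟫ = 0) (hTB : ⟪T, B⟫ = 0) (hNB : ⟪N, B⟫ = 0) (t a b c a' b' c' : ℝ) :
    ⟪rotatedFrameComb T N B t a b c, rotatedFrameComb T N B t a' b' c'⟫
      = a * a' + b * b' + c * c' := by
  have hNT : ⟪N, T⟫ = 0 := by rw [real_inner_comm, hTN]
  have hBT : ⟪B, T⟫ = 0 := by rw [real_inner_comm, hTB]
  have hBN : ⟪B, N⟫ = 0 := by rw [real_inner_comm, hNB]
  simp only [rotatedFrameComb, inner_add_left, inner_add_right, real_inner_smul_left,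
    real_inner_smul_right, real_inner_self_eq_norm_sq, hT, hN, hB, hTN, hTB, hNB, hNT, hBT, hBN]
  linear_combination (b * b' + c * c') * Real.sin_sq_add_cos_sq t

theorem deriv_rotatedFrameComb_angle (T N B : V) (a b c t : ℝ) :
    deriv (fun x => rotatedFrameComb T N B x a b c) t = rotatedFrameComb T N B t 0 (-c) b := by
  have hs := Real.hasDerivAt_sin t
  have hc := Real.hasDerivAt_cos t
  have h := ((((hs.const_mul c).sub (hc.const_mul b)).smul_const N).const_add (a • T)).add
    (((hs.const_mul b).add (hc.const_mul c)).smul_const B)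
  refine h.deriv.trans ?_
  simp only [rotatedFrameComb]
  module

theorem deriv_rotatedFrameComb_param {T N B : ℝ → V} {τ : ℝ} {a b c : ℝ → ℝ} {s : ℝ}
    (hT : HasDerivAt T 0 s) (hN : HasDerivAt N (τ • B s) s) (hB : HasDerivAt B (-τ • N s) s)
    (ha : DifferentiableAt ℝ a s) (hb : DifferentiableAt ℝ b s) (hc : DifferentiableAt ℝ c s)
    (t : ℝ) :
    deriv (fun x => rotatedFrameComb (T x) (N x) (B x) t (a x) (b x) (c x)) s =
      rotatedFrameComb (T s) (N s) (B s) t (deriv a s) (deriv b s + τ * c s)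
        (deriv c s - τ * b s) := by
  have hb := hb.hasDerivAt
  have hc := hc.hasDerivAt
  have h := ((ha.hasDerivAt.smul hT).add
    (((hc.mul_const (Real.sin t)).sub (hb.mul_const (Real.cos t))).smul hN)).add
    (((hb.mul_const (Real.sin t)).add (hc.mul_const (Real.cos t))).smul hB)
  refine h.deriv.trans ?_
  simp only [rotatedFrameComb, Pi.add_apply, Pi.sub_apply]
  module

end RotatedFrame

theorem revolution_is_HK_Weingarten
    (α T N B : ℝ → EuclideanSpace ℝ (Fin 3)) (κ τ r : ℝ → ℝ)
    (hα : ContDiff ℝ (⊤ : ℕ∞) α) (hT : ContDiff ℝ (⊤ : ℕ∞) T)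
    (hN : ContDiff ℝ (⊤ : ℕ∞) N) (hB : ContDiff ℝ (⊤ : ℕ∞) B)
    (hκ : ContDiff ℝ (⊤ : ℕ∞) κ) (hτ : ContDiff ℝ (⊤ : ℕ∞) τ)
    (hr : ContDiff ℝ (⊤ : ℕ∞) r)
    (hTα : ∀ s, T s = deriv α s)
    (hT1 : ∀ s, ‖T s‖ = 1) (hN1 : ∀ s, ‖N s‖ = 1) (hB1 : ∀ s, ‖B s‖ = 1)
    (hTN : ∀ s, ⟪T s, N s⟫ = 0) (hTB : ∀ s, ⟪T s, B s⟫ = 0)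
    (hNB : ∀ s, ⟪N s, B s⟫ = 0)
    (hT' : ∀ s, deriv T s = κ s • N s)
    (hN' : ∀ s, deriv N s = (-κ s) • T s + τ s • B s)
    (hB' : ∀ s, deriv B s = (-τ s) • N s)
    (hrpos : ∀ s, 0 < r s) (hr1 : ∀ s, |deriv r s| < 1)
    (R Q : ℝ → ℝ)
    (hR : ∀ s, R s = r s * deriv r s)
    (hQ : ∀ s, Q s = r s * Real.sqrt (1 - (deriv r s) ^ 2))
    (C : ℝ → ℝ → EuclideanSpace ℝ (Fin 3))
    (hC : ∀ s t, C s t = α s - R s • T s - (Q s * Real.cos t) • N s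
      + (Q s * Real.sin t) • B s)
    (Cs Ct : ℝ → ℝ → EuclideanSpace ℝ (Fin 3))
    (hCs : ∀ s t, Cs s t = deriv (fun u => C u t) s)
    (hCt : ∀ s t, Ct s t = deriv (fun u => C s u) t)
    (E F G : ℝ → ℝ → ℝ)
    (hE : ∀ s t, E s t = ⟪Cs s t, Cs s t⟫)
    (hF : ∀ s t, F s t = ⟪Cs s t, Ct s t⟫)
    (hG : ∀ s t, G s t = ⟪Ct s t, Ct s t⟫)
    (n : ℝ → ℝ → EuclideanSpace ℝ (Fin 3))
    (hn : ∀ s t, n s t = (r s)⁻¹ • (C s t - α s))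
    (Css Cst Ctt : ℝ → ℝ → EuclideanSpace ℝ (Fin 3))
    (hCss : ∀ s t, Css s t = deriv (fun u => Cs u t) s)
    (hCst : ∀ s t, Cst s t = deriv (fun u => Cs s u) t)
    (hCtt : ∀ s t, Ctt s t = deriv (fun u => Ct s u) t)
    (e f g : ℝ → ℝ → ℝ)
    (he : ∀ s t, e s t = ⟪Css s t, n s t⟫)
    (hf : ∀ s t, f s t = ⟪Cst s t, n s t⟫)
    (hg : ∀ s t, g s t = ⟪Ctt s t, n s t⟫)
    (K : ℝ → ℝ → ℝ)
    (hK : ∀ s t, K s t = (e s t * g s t - f s t ^ 2) / (E s t * G s t - F s t ^ 2))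
    (H : ℝ → ℝ → ℝ)
    (hH : ∀ s t, H s t = (E s t * g s t - 2 * F s t * f s t + G s t * e s t)
      / (2 * (E s t * G s t - F s t ^ 2)))
    (Ks Kt : ℝ → ℝ → ℝ)
    (hKs : ∀ s t, Ks s t = deriv (fun u => K u t) s)
    (hKt : ∀ s t, Kt s t = deriv (fun u => K s u) t)
    (Hs Ht : ℝ → ℝ → ℝ)
    (hHs : ∀ s t, Hs s t = deriv (fun u => H u t) s)
    (hHt : ∀ s t, Ht s t = deriv (fun u => H s u) t)
    (hκ0 : ∀ s, κ s = 0)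
    (hreg : ∀ s t, E s t * G s t - F s t ^ 2 ≠ 0)
    :
    ∀ s t : ℝ, Ht s t * Ks s t - Hs s t * Kt s t = 0 := by
  have hr' : ContDiff ℝ (⊤ : ℕ∞) (deriv r) := (contDiff_infty_iff_deriv.1 hr).2
  have hRs : ContDiff ℝ (⊤ : ℕ∞) R := by
    rw [funext hR]
    exact hr.mul hr'
  have hQs : ContDiff ℝ (⊤ : ℕ∞) Q := by
    rw [funext hQ]
    refine hr.mul ((contDiff_const.sub (hr'.pow 2)).sqrt fun s => ?_)
    exact (sub_pos.2 ((sq_lt_one_iff_abs_lt_one _).2 (hr1 s))).ne'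
  have hR's : ContDiff ℝ (⊤ : ℕ∞) (deriv R) := (contDiff_infty_iff_deriv.1 hRs).2
  have hQ's : ContDiff ℝ (⊤ : ℕ∞) (deriv Q) := (contDiff_infty_iff_deriv.1 hQs).2
  have diff {W : Type} [NormedAddCommGroup W] [NormedSpace ℝ W] {φ : ℝ → W}
      (h : ContDiff ℝ (⊤ : ℕ∞) φ) (s : ℝ) : DifferentiableAt ℝ φ s :=
    (h.differentiable (by simp)) s
  have dα (s) : HasDerivAt α (T s) s := hTα s ▸ (diff hα s).hasDerivAt
  have dT (s) : HasDerivAt T 0 s := by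
    simpa [hT', hκ0] using (diff hT s).hasDerivAt
  have dN (s) : HasDerivAt N (τ s • B s) s := by
    simpa [hN', hκ0] using (diff hN s).hasDerivAt
  have dB (s) : HasDerivAt B (-τ s • N s) s := by
    simpa [hB'] using (diff hB s).hasDerivAt
  have C_eq (s t) : C s t = α s + rotatedFrameComb (T s) (N s) (B s) t (-R s) (Q s) 0 := by
    rw [hC]
    simp only [rotatedFrameComb]
    module
  have n_eq (s t) : n s t = rotatedFrameComb (T s) (N s) (B s) t
      ((r s)⁻¹ * -R s) ((r s)⁻¹ * Q s) 0 := by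
    rw [hn, C_eq]
    simp only [rotatedFrameComb]
    module
  have Cs_eq (s t) : Cs s t = rotatedFrameComb (T s) (N s) (B s) t
      (1 - deriv R s) (deriv Q s) (-(τ s * Q s)) := by
    have h : DifferentiableAt ℝ
        (fun x => rotatedFrameComb (T x) (N x) (B x) t (-R x) (Q x) 0) s := by
      have := diff hRs s
      have := diff hQs s
      have := diff hT s
      have := diff hN s
      have := diff hB s
      unfold rotatedFrameComb
      fun_prop
    simp only [hCs, C_eq]
    rw [deriv_fun_add (dα s).differentiableAt h, (dα s).deriv,
      deriv_rotatedFrameComb_param (a := fun x => -R x) (c := fun _ => 0) (dT s) (dN s) (dB s)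
        (diff hRs s).neg (diff hQs s) (differentiableAt_const 0)]
    simp only [rotatedFrameComb, deriv.fun_neg, deriv_const]
    module
  have Ct_eq (s t) : Ct s t = rotatedFrameComb (T s) (N s) (B s) t 0 0 (Q s) := by
    simp only [hCt, C_eq, deriv_const_add, deriv_rotatedFrameComb_angle, neg_zero]
  have Css_eq (s t) : Css s t = rotatedFrameComb (T s) (N s) (B s) t
      (deriv (fun x => 1 - deriv R x) s) (deriv (deriv Q) s + τ s * -(τ s * Q s))
      (deriv (fun x => -(τ x * Q x)) s - τ s * deriv Q s) := by
    simp only [hCss, Cs_eq]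
    exact deriv_rotatedFrameComb_param (dT s) (dN s) (dB s) ((diff hR's s).const_sub 1)
      (diff hQ's s) ((diff hτ s).mul (diff hQs s)).neg t
  have Cst_eq (s t) : Cst s t = rotatedFrameComb (T s) (N s) (B s) t
      0 (τ s * Q s) (deriv Q s) := by
    simp only [hCst, Cs_eq, deriv_rotatedFrameComb_angle, neg_neg]
  have Ctt_eq (s t) : Ctt s t = rotatedFrameComb (T s) (N s) (B s) t 0 (-Q s) 0 := by
    simp only [hCtt, Ct_eq, deriv_rotatedFrameComb_angle]
  have inner_eq (s) := inner_rotatedFrameComb (hT1 s) (hN1 s) (hB1 s) (hTN s) (hTB s) (hNB s)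
  have K_const (s t) : K s t = K s 0 := by
    simp only [hK, hE, hF, hG, he, hf, hg, n_eq, Cs_eq, Ct_eq, Css_eq, Cst_eq, Ctt_eq, inner_eq]
  have H_const (s t) : H s t = H s 0 := by
    simp only [hH, hE, hF, hG, he, hf, hg, n_eq, Cs_eq, Ct_eq, Css_eq, Cst_eq, Ctt_eq, inner_eq]
  intro s t
  have hKt0 : Kt s t = 0 := by
    rw [hKt, funext (K_const s), deriv_const]
  have hHt0 : Ht s t = 0 := by
    rw [hHt, funext (H_const s), deriv_const]
  rw [hKt0, hHt0, zero_mul, mul_zero, sub_zero]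
end

section
/- Every canal surface of revolution is a (H,K_II)-Weingarten surface: if the curvature of the center curve vanishes identically (κ(s) = 0 for all s) and (EG − F²)(s,t) ≠ 0 and (eg − f²)(s,t) ≠ 0 for all (s,t), then the Jacobi equation Φ(H,K_II) = H_t·(K_II)_s − H_s·(K_II)_t = 0 holds at every point (s,t). -/
open scoped RealInnerProductSpace

/-- The vector with components `a`, `b`, `c` in the orthonormal frame
`(x, -cos t • y + sin t • z, sin t • y + cos t • z)`, obtained from `(x, y, z)` by rotating
the plane of `y` and `z`. -/
noncomputable def rotatedFrameVec (x y z : EuclideanSpace ℝ (Fin 3)) (a b c t : ℝ) :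
    EuclideanSpace ℝ (Fin 3) :=
  a • x + (c * Real.sin t - b * Real.cos t) • y + (b * Real.sin t + c * Real.cos t) • z

theorem inner_rotatedFrameVec {x y z : EuclideanSpace ℝ (Fin 3)}
    (hx : ‖x‖ = 1) (hy : ‖y‖ = 1) (hz : ‖z‖ = 1)
    (hxy : ⟪x, y⟫ = 0) (hxz : ⟪x, z⟫ = 0) (hyz : ⟪y, z⟫ = 0) (a b c a' b' c' t : ℝ) :
    ⟪rotatedFrameVec x y z a b c t, rotatedFrameVec x y z a' b' c' t⟫ =
      a * a' + b * b' + c * c' := by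
  have hyx : ⟪y, x⟫ = 0 := by rw [real_inner_comm, hxy]
  have hzx : ⟪z, x⟫ = 0 := by rw [real_inner_comm, hxz]
  have hzy : ⟪z, y⟫ = 0 := by rw [real_inner_comm, hyz]
  simp only [rotatedFrameVec, inner_add_left, inner_add_right, real_inner_smul_left,
    real_inner_smul_right, real_inner_self_eq_norm_sq, hx, hy, hz, hxy, hxz, hyz, hyx, hzx, hzy]
  linear_combination (b * b' + c * c') * Real.sin_sq_add_cos_sq t

theorem hasDerivAt_rotatedFrameVec_angle (x y z : EuclideanSpace ℝ (Fin 3)) (a b c t : ℝ) :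
    HasDerivAt (fun u => rotatedFrameVec x y z a b c u) (rotatedFrameVec x y z 0 (-c) b t) t := by
  have hsin := Real.hasDerivAt_sin t
  have hcos := Real.hasDerivAt_cos t
  have h := (((hsin.const_mul c).sub (hcos.const_mul b)).smul_const y).const_add (a • x) |>.add
    (((hsin.const_mul b).add (hcos.const_mul c)).smul_const z)
  refine h.congr_deriv ?_
  simp only [rotatedFrameVec]
  module

/-- The derivative along a curve with vanishing curvature and torsion `τ` of a vector with
components `a`, `b`, `c` in the rotated Frenet frame. -/
theorem hasDerivAt_rotatedFrameVec_curve {T N B : ℝ → EuclideanSpace ℝ (Fin 3)}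
    {a b c : ℝ → ℝ} {a' b' c' τ s : ℝ}
    (hT : HasDerivAt T 0 s) (hN : HasDerivAt N (τ • B s) s) (hB : HasDerivAt B (-τ • N s) s)
    (ha : HasDerivAt a a' s) (hb : HasDerivAt b b' s) (hc : HasDerivAt c c' s) (t : ℝ) :
    HasDerivAt (fun u => rotatedFrameVec (T u) (N u) (B u) (a u) (b u) (c u) t)
      (rotatedFrameVec (T s) (N s) (B s) a' (b' + τ * c s) (c' - τ * b s) t) s := by
  have h := ((ha.smul hT).add
    (((hc.mul_const (Real.sin t)).sub (hb.mul_const (Real.cos t))).smul hN)).add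
    (((hb.mul_const (Real.sin t)).add (hc.mul_const (Real.cos t))).smul hB)
  refine h.congr_deriv ?_
  simp only [rotatedFrameVec, Pi.sub_apply, Pi.add_apply]
  module

theorem revolution_is_HKII_Weingarten
    (α T N B : ℝ → EuclideanSpace ℝ (Fin 3)) (κ τ r : ℝ → ℝ)
    (hα : ContDiff ℝ (⊤ : ℕ∞) α) (hT : ContDiff ℝ (⊤ : ℕ∞) T)
    (hN : ContDiff ℝ (⊤ : ℕ∞) N) (hB : ContDiff ℝ (⊤ : ℕ∞) B)
    (hκ : ContDiff ℝ (⊤ : ℕ∞) κ) (hτ : ContDiff ℝ (⊤ : ℕ∞) τ)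
    (hr : ContDiff ℝ (⊤ : ℕ∞) r)
    (hTα : ∀ s, T s = deriv α s)
    (hT1 : ∀ s, ‖T s‖ = 1) (hN1 : ∀ s, ‖N s‖ = 1) (hB1 : ∀ s, ‖B s‖ = 1)
    (hTN : ∀ s, ⟪T s, N s⟫ = 0) (hTB : ∀ s, ⟪T s, B s⟫ = 0)
    (hNB : ∀ s, ⟪N s, B s⟫ = 0)
    (hT' : ∀ s, deriv T s = κ s • N s)
    (hN' : ∀ s, deriv N s = (-κ s) • T s + τ s • B s)
    (hB' : ∀ s, deriv B s = (-τ s) • N s)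
    (hrpos : ∀ s, 0 < r s) (hr1 : ∀ s, |deriv r s| < 1)
    (R Q : ℝ → ℝ)
    (hR : ∀ s, R s = r s * deriv r s)
    (hQ : ∀ s, Q s = r s * Real.sqrt (1 - (deriv r s) ^ 2))
    (C : ℝ → ℝ → EuclideanSpace ℝ (Fin 3))
    (hC : ∀ s t, C s t = α s - R s • T s - (Q s * Real.cos t) • N s
      + (Q s * Real.sin t) • B s)
    (Cs Ct : ℝ → ℝ → EuclideanSpace ℝ (Fin 3))
    (hCs : ∀ s t, Cs s t = deriv (fun u => C u t) s)
    (hCt : ∀ s t, Ct s t = deriv (fun u => C s u) t)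
    (E F G : ℝ → ℝ → ℝ)
    (hE : ∀ s t, E s t = ⟪Cs s t, Cs s t⟫)
    (hF : ∀ s t, F s t = ⟪Cs s t, Ct s t⟫)
    (hG : ∀ s t, G s t = ⟪Ct s t, Ct s t⟫)
    (n : ℝ → ℝ → EuclideanSpace ℝ (Fin 3))
    (hn : ∀ s t, n s t = (r s)⁻¹ • (C s t - α s))
    (Css Cst Ctt : ℝ → ℝ → EuclideanSpace ℝ (Fin 3))
    (hCss : ∀ s t, Css s t = deriv (fun u => Cs u t) s)
    (hCst : ∀ s t, Cst s t = deriv (fun u => Cs s u) t)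
    (hCtt : ∀ s t, Ctt s t = deriv (fun u => Ct s u) t)
    (e f g : ℝ → ℝ → ℝ)
    (he : ∀ s t, e s t = ⟪Css s t, n s t⟫)
    (hf : ∀ s t, f s t = ⟪Cst s t, n s t⟫)
    (hg : ∀ s t, g s t = ⟪Ctt s t, n s t⟫)
    (H : ℝ → ℝ → ℝ)
    (hH : ∀ s t, H s t = (E s t * g s t - 2 * F s t * f s t + G s t * e s t)
      / (2 * (E s t * G s t - F s t ^ 2)))
    (es et ett fs ft fst gs gt gss : ℝ → ℝ → ℝ)
    (hes : ∀ s t, es s t = deriv (fun u => e u t) s)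
    (het : ∀ s t, et s t = deriv (fun u => e s u) t)
    (hett : ∀ s t, ett s t = deriv (fun u => et s u) t)
    (hfs : ∀ s t, fs s t = deriv (fun u => f u t) s)
    (hft : ∀ s t, ft s t = deriv (fun u => f s u) t)
    (hfst : ∀ s t, fst s t = deriv (fun u => fs s u) t)
    (hgs : ∀ s t, gs s t = deriv (fun u => g u t) s)
    (hgt : ∀ s t, gt s t = deriv (fun u => g s u) t)
    (hgss : ∀ s t, gss s t = deriv (fun u => gs u t) s)
    (KII : ℝ → ℝ → ℝ)
    (hKII : ∀ s t, KII s t = (e s t * g s t - f s t ^ 2)⁻¹ ^ 2 *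
      (Matrix.det !![-(1 / 2) * ett s t + fst s t - (1 / 2) * gss s t,
          (1 / 2) * es s t, fs s t - (1 / 2) * et s t;
          ft s t - (1 / 2) * gs s t, e s t, f s t;
          (1 / 2) * gt s t, f s t, g s t] -
        Matrix.det !![0, (1 / 2) * et s t, (1 / 2) * gs s t;
          (1 / 2) * et s t, e s t, f s t;
          (1 / 2) * gs s t, f s t, g s t]))
    (Hs Ht : ℝ → ℝ → ℝ)
    (hHs : ∀ s t, Hs s t = deriv (fun u => H u t) s)
    (hHt : ∀ s t, Ht s t = deriv (fun u => H s u) t)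
    (KIIs KIIt : ℝ → ℝ → ℝ)
    (hKIIs : ∀ s t, KIIs s t = deriv (fun u => KII u t) s)
    (hKIIt : ∀ s t, KIIt s t = deriv (fun u => KII s u) t)
    (hκ0 : ∀ s, κ s = 0)
    (hreg : ∀ s t, E s t * G s t - F s t ^ 2 ≠ 0)
    (hreg2 : ∀ s t, e s t * g s t - f s t ^ 2 ≠ 0)
    :
    ∀ s t : ℝ, Ht s t * KIIs s t - Hs s t * KIIt s t = 0 := by
  have hdT : ∀ s, HasDerivAt T 0 s := fun s => by
    have h := (hT.differentiable (by simp) s).hasDerivAt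
    rwa [hT', hκ0, zero_smul] at h
  have hdN : ∀ s, HasDerivAt N (τ s • B s) s := fun s => by
    have h := (hN.differentiable (by simp) s).hasDerivAt
    rwa [hN', hκ0, neg_zero, zero_smul, zero_add] at h
  have hdB : ∀ s, HasDerivAt B (-τ s • N s) s := fun s => by
    have h := (hB.differentiable (by simp) s).hasDerivAt
    rwa [hB'] at h
  have hdα : ∀ s, HasDerivAt α (T s) s := fun s => by
    rw [hTα]
    exact (hα.differentiable (by simp) s).hasDerivAt
  have hr' : ContDiff ℝ (⊤ : ℕ∞) (deriv r) := (contDiff_infty_iff_deriv.1 hr).2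
  have hRsm : ContDiff ℝ (⊤ : ℕ∞) R := by
    rw [funext hR]
    exact hr.mul hr'
  have hQsm : ContDiff ℝ (⊤ : ℕ∞) Q := by
    rw [funext hQ]
    refine hr.mul ((contDiff_const.sub (hr'.pow 2)).sqrt fun s => ?_)
    have h := (sq_lt_one_iff_abs_lt_one (deriv r s)).2 (hr1 s)
    linarith
  have hdR : ∀ s, HasDerivAt R (deriv R s) s := fun s =>
    (hRsm.differentiable (by simp) s).hasDerivAt
  have hdQ : ∀ s, HasDerivAt Q (deriv Q s) s := fun s =>
    (hQsm.differentiable (by simp) s).hasDerivAt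
  have hddR : ∀ s, HasDerivAt (deriv R) (deriv (deriv R) s) s := fun s =>
    ((contDiff_infty_iff_deriv.1 hRsm).2.differentiable (by simp) s).hasDerivAt
  have hddQ : ∀ s, HasDerivAt (deriv Q) (deriv (deriv Q) s) s := fun s =>
    ((contDiff_infty_iff_deriv.1 hQsm).2.differentiable (by simp) s).hasDerivAt
  have hdτ : ∀ s, HasDerivAt τ (deriv τ s) s := fun s =>
    (hτ.differentiable (by simp) s).hasDerivAt
  have hCvec : ∀ s t, C s t = α s + rotatedFrameVec (T s) (N s) (B s) (-R s) (Q s) 0 t := by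
    intro s t
    rw [hC, rotatedFrameVec]
    module
  have hCsvec : ∀ s t, Cs s t =
      rotatedFrameVec (T s) (N s) (B s) (1 - deriv R s) (deriv Q s) (-(τ s * Q s)) t := by
    intro s t
    have h := (hdα s).add (hasDerivAt_rotatedFrameVec_curve (hdT s) (hdN s) (hdB s)
      (hdR s).neg (hdQ s) (hasDerivAt_const s 0) t)
    rw [hCs, funext fun u => hCvec u t]
    refine h.deriv.trans ?_
    simp only [rotatedFrameVec]
    module
  have hCtvec : ∀ s t, Ct s t = rotatedFrameVec (T s) (N s) (B s) 0 0 (Q s) t := by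
    intro s t
    rw [hCt, funext fun u => hCvec s u]
    simpa using ((hasDerivAt_rotatedFrameVec_angle (T s) (N s) (B s) (-R s) (Q s) 0 t).const_add
      (α s)).deriv
  have hCssvec : ∀ s t, Css s t = rotatedFrameVec (T s) (N s) (B s) (-deriv (deriv R) s)
      (deriv (deriv Q) s + τ s * -(τ s * Q s))
      (-(deriv τ s * Q s + τ s * deriv Q s) - τ s * deriv Q s) t := by
    intro s t
    rw [hCss, funext fun u => hCsvec u t]
    exact (hasDerivAt_rotatedFrameVec_curve (hdT s) (hdN s) (hdB s)
      ((hddR s).const_sub 1) (hddQ s) ((hdτ s).mul (hdQ s)).neg t).deriv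
  have hCstvec : ∀ s t, Cst s t =
      rotatedFrameVec (T s) (N s) (B s) 0 (- -(τ s * Q s)) (deriv Q s) t := by
    intro s t
    rw [hCst, funext fun u => hCsvec s u]
    exact (hasDerivAt_rotatedFrameVec_angle _ _ _ _ _ _ t).deriv
  have hCttvec : ∀ s t, Ctt s t = rotatedFrameVec (T s) (N s) (B s) 0 (-Q s) 0 t := by
    intro s t
    rw [hCtt, funext fun u => hCtvec s u]
    exact (hasDerivAt_rotatedFrameVec_angle _ _ _ _ _ _ t).deriv
  have hinner := fun s => inner_rotatedFrameVec (hT1 s) (hN1 s) (hB1 s) (hTN s) (hTB s) (hNB s)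
  have hE0 : ∀ s t, E s t = E s 0 := fun s t => by simp only [hE, hCsvec, hinner]
  have hF0 : ∀ s t, F s t = F s 0 := fun s t => by simp only [hF, hCsvec, hCtvec, hinner]
  have hG0 : ∀ s t, G s t = G s 0 := fun s t => by simp only [hG, hCtvec, hinner]
  have he0 : ∀ s t, e s t = e s 0 := fun s t => by
    simp only [he, hn, hCvec, add_sub_cancel_left, real_inner_smul_right, hCssvec, hinner]
  have hf0 : ∀ s t, f s t = f s 0 := fun s t => by
    simp only [hf, hn, hCvec, add_sub_cancel_left, real_inner_smul_right, hCstvec, hinner]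
  have hg0 : ∀ s t, g s t = g s 0 := fun s t => by
    simp only [hg, hn, hCvec, add_sub_cancel_left, real_inner_smul_right, hCttvec, hinner]
  have hes0 : ∀ s t, es s t = es s 0 := fun s t => by rw [hes, hes, funext fun u => he0 u t]
  have hfs0 : ∀ s t, fs s t = fs s 0 := fun s t => by rw [hfs, hfs, funext fun u => hf0 u t]
  have hgs0 : ∀ s t, gs s t = gs s 0 := fun s t => by rw [hgs, hgs, funext fun u => hg0 u t]
  have hgss0 : ∀ s t, gss s t = gss s 0 := fun s t => by
    rw [hgss, hgss, funext fun u => hgs0 u t]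
  have het0 : ∀ s t, et s t = 0 := fun s t => by rw [het, funext (he0 s), deriv_const]
  have hft0 : ∀ s t, ft s t = 0 := fun s t => by rw [hft, funext (hf0 s), deriv_const]
  have hgt0 : ∀ s t, gt s t = 0 := fun s t => by rw [hgt, funext (hg0 s), deriv_const]
  have hett0 : ∀ s t, ett s t = 0 := fun s t => by rw [hett, funext (het0 s), deriv_const]
  have hfst0 : ∀ s t, fst s t = 0 := fun s t => by rw [hfst, funext (hfs0 s), deriv_const]
  have hH0 : ∀ s t, H s t = H s 0 := fun s t => by
    rw [hH, hH, hE0 s t, hF0 s t, hG0 s t, he0 s t, hf0 s t, hg0 s t]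
  have hKII0 : ∀ s t, KII s t = KII s 0 := fun s t => by
    rw [hKII, hKII, he0 s t, hf0 s t, hg0 s t, hes0 s t, hfs0 s t, hgs0 s t, hgss0 s t]
    simp only [het0, hft0, hgt0, hett0, hfst0]
  intro s t
  rw [hHt, hKIIt, funext (hH0 s), funext (hKII0 s), deriv_const, deriv_const]
  ring
end
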